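/- Fix t > 0 and a compact interval [a,b] ⊂ ℝ with a < b. There exists a constant K = K(t,a,b) > 0 such that for every 0 < r ≤ b − a, every integer n ≥ 1, all reals a_1,…,a_n, and all points y, x_1,…,x_n ∈ [a,b] satisfying r ≤ |y − x_k| ≤ b − a for every k, one has ∫_0^t ∫_ℝ (G(t−s, y−z) − Σ_{k=1}^{n} a_k G(t−s, x_k−z))² dz ds ≥ K r. (This is the strong local nondeterminism of the mild solution u(t,·) of the stochastic heat equation in the space variable: the left-hand side equals E[(u(t,y) − Σ_k a_k u(t,x_k))²].) -/

import Mathlib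

open MeasureTheory Real

/-- The Green kernel (heat kernel) of the heat equation `∂ₜu = (1/2)Δu` on `ℝ`. -/
noncomputable def G (t x : ℝ) : ℝ :=
  if 0 < t then (1 / Real.sqrt (2 * Real.pi * t)) * Real.exp (-x ^ 2 / (2 * t)) else 0

lemma G_of_pos {t : ℝ} (ht : 0 < t) (x : ℝ) :
    G t x = (1 / √(2 * π * t)) * exp (-x ^ 2 / (2 * t)) := if_pos ht

lemma G_nonneg (t x : ℝ) : 0 ≤ G t x := by
  unfold G; split_ifs <;> positivity

lemma measurable_uncurry_G : Measurable (Function.uncurry G) := by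
  unfold G Function.uncurry
  refine Measurable.ite (measurableSet_lt measurable_const measurable_fst) ?_ measurable_const
  fun_prop

lemma G_eq_gaussianPDFReal {t : ℝ} (ht : 0 < t) :
    G t = ProbabilityTheory.gaussianPDFReal 0 t.toNNReal := by
  funext x
  simp [G_of_pos ht, ProbabilityTheory.gaussianPDFReal_def, ht.le]

lemma integrable_G {t : ℝ} (ht : 0 < t) : Integrable (G t) := by
  rw [G_eq_gaussianPDFReal ht]
  exact ProbabilityTheory.integrable_gaussianPDFReal _ _

lemma integral_G {t : ℝ} (ht : 0 < t) : ∫ x, G t x = 1 := by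
  rw [G_eq_gaussianPDFReal ht]
  exact ProbabilityTheory.integral_gaussianPDFReal_eq_one _
    (Real.toNNReal_pos.2 ht).ne'

lemma hasDerivAt_G_one (x : ℝ) : HasDerivAt (G 1) (-(x * G 1 x)) x := by
  have h : G 1 = fun x => (1 / √(2 * π * 1)) * exp (-x ^ 2 / (2 * 1)) :=
    funext (G_of_pos one_pos)
  rw [h]
  refine ((((hasDerivAt_id x).fun_pow 2).fun_neg.div_const (2 * 1)).exp.const_mul
    (1 / √(2 * π * 1))).congr_deriv ?_
  simp only [id_eq]
  ring

lemma integrable_mul_G_one : Integrable (fun x => x * G 1 x) := by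
  have h := (integrable_mul_exp_neg_mul_sq (b := 1 / 2) (by norm_num)).const_mul
    (1 / √(2 * π * 1))
  refine h.congr (Filter.Eventually.of_forall fun x => ?_)
  simp only [G_of_pos one_pos]
  rw [show -(1 / 2) * x ^ 2 = -x ^ 2 / (2 * 1) by ring]
  ring

/-- The heat semigroup `∫ f(x + √σ ξ) G(1, ξ) dξ`, in a form that is continuous at `σ = 0`. -/
noncomputable def heatAvg (f : ℝ → ℝ) (x σ : ℝ) : ℝ := ∫ ξ, f (x + √σ * ξ) * G 1 ξ

lemma heatAvg_eq_integral_G (f : ℝ → ℝ) (x : ℝ) {σ : ℝ} (hσ : 0 < σ) :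
    ∫ z, G σ (x - z) * f z = heatAvg f x σ := by
  have hs : 0 < √σ := sqrt_pos.2 hσ
  have h1 := integral_add_left_eq_self (μ := volume) (fun z => G σ (x - z) * f z) x
  have h2 := Measure.integral_comp_mul_left (fun u => G σ (x - (x + u)) * f (x + u)) (√σ)
  rw [h1, smul_eq_mul, abs_of_pos (inv_pos.2 hs)] at h2
  have h3 : heatAvg f x σ = √σ * ∫ ξ, G σ (x - (x + √σ * ξ)) * f (x + √σ * ξ) := by
    rw [heatAvg, ← integral_const_mul]
    refine integral_congr_ae (Filter.Eventually.of_forall fun ξ => ?_)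
    simp only [G_of_pos one_pos, G_of_pos hσ]
    have : -(x - (x + √σ * ξ)) ^ 2 / (2 * σ) = -ξ ^ 2 / (2 * 1) := by
      rw [show (x - (x + √σ * ξ)) ^ 2 = (√σ) ^ 2 * ξ ^ 2 by ring, sq_sqrt hσ.le]
      field_simp
    rw [this, sqrt_mul (by positivity) σ, sqrt_mul (by positivity) 1, sqrt_one]
    field_simp
  rw [h3, h2]
  field_simp

lemma integrable_comp_mul_G_one {f : ℝ → ℝ} {B : ℝ} (hf : Continuous f) (hB : ∀ x, |f x| ≤ B)
    (x σ : ℝ) : Integrable (fun ξ => f (x + √σ * ξ) * G 1 ξ) :=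
  (integrable_G one_pos).bdd_mul (by fun_prop) (Filter.Eventually.of_forall fun _ => hB _)

lemma continuous_heatAvg {f : ℝ → ℝ} {B : ℝ} (hf : Continuous f) (hB : ∀ x, |f x| ≤ B) (x : ℝ) :
    Continuous (heatAvg f x) := by
  refine continuous_of_dominated (bound := fun ξ => B * G 1 ξ)
    (fun σ => (integrable_comp_mul_G_one hf hB x σ).aestronglyMeasurable)
    (fun σ => Filter.Eventually.of_forall fun ξ => ?_) ((integrable_G one_pos).const_mul B)
    (Filter.Eventually.of_forall fun ξ => by fun_prop)
  rw [norm_mul, norm_eq_abs, norm_eq_abs, abs_of_nonneg (G_nonneg 1 ξ)]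
  exact mul_le_mul_of_nonneg_right (hB _) (G_nonneg 1 ξ)

lemma heatAvg_zero (f : ℝ → ℝ) (x : ℝ) : heatAvg f x 0 = f x := by
  simp [heatAvg, integral_const_mul, integral_G one_pos]

lemma hasDerivAt_heatAvg {h h₁ h₂ : ℝ → ℝ} {B B₁ B₂ : ℝ}
    (hd : ∀ x, HasDerivAt h (h₁ x) x) (hd₁ : ∀ x, HasDerivAt h₁ (h₂ x) x) (hc : Continuous h₂)
    (hB : ∀ x, |h x| ≤ B) (hB₁ : ∀ x, |h₁ x| ≤ B₁) (hB₂ : ∀ x, |h₂ x| ≤ B₂)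
    (x : ℝ) {σ : ℝ} (hσ : 0 < σ) :
    HasDerivAt (heatAvg h x) (heatAvg h₂ x σ / 2) σ := by
  have hh : Continuous h := continuous_iff_continuousAt.2 fun x => (hd x).continuousAt
  have hh₁ : Continuous h₁ := continuous_iff_continuousAt.2 fun x => (hd₁ x).continuousAt
  have hs : 0 < √σ := sqrt_pos.2 hσ
  have hG : Continuous (G 1) := continuous_iff_continuousAt.2 fun x =>
    (hasDerivAt_G_one x).continuousAt
  have hint : Integrable (fun ξ => h₁ (x + √σ * ξ) * (ξ * G 1 ξ)) :=
    integrable_mul_G_one.bdd_mul (by fun_prop) (Filter.Eventually.of_forall fun _ => hB₁ _)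
  have key := (hasDerivAt_integral_of_dominated_loc_of_deriv_le (μ := volume)
    (F := fun σ ξ => h (x + √σ * ξ) * G 1 ξ)
    (F' := fun σ ξ => h₁ (x + √σ * ξ) * (1 / (2 * √σ) * ξ) * G 1 ξ)
    (bound := fun ξ => B₁ * (1 / (2 * √(σ / 2))) * |ξ * G 1 ξ|)
    (Ioi_mem_nhds (half_lt_self hσ))
    (Filter.Eventually.of_forall fun σ =>
      (integrable_comp_mul_G_one hh hB x σ).aestronglyMeasurable)
    (integrable_comp_mul_G_one hh hB x σ)
    (by fun_prop)
    (Filter.Eventually.of_forall fun ξ τ hτ => ?_)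
    (integrable_mul_G_one.abs.const_mul _)
    (Filter.Eventually.of_forall fun ξ τ hτ => ?_)).2
  · refine key.congr_deriv ?_
    have ibp := integral_mul_deriv_eq_deriv_mul_of_integrable
      (u := fun ξ => h₁ (x + √σ * ξ)) (u' := fun ξ => h₂ (x + √σ * ξ) * √σ)
      (v := fun ξ => -G 1 ξ) (v' := fun ξ => ξ * G 1 ξ)
      (fun ξ _ => by
        have := ((hasDerivAt_id ξ).const_mul (√σ)).const_add x
        exact ((hd₁ (x + √σ * ξ)).comp ξ this).congr_deriv (by simp))
      (fun ξ _ => (hasDerivAt_G_one ξ).neg.congr_deriv (neg_neg _))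
      hint
      (by
        refine ((integrable_comp_mul_G_one hc hB₂ x σ).const_mul (-√σ)).congr
          (Filter.Eventually.of_forall fun ξ => ?_)
        simp only [Pi.mul_apply]; ring)
      (by
        refine (integrable_comp_mul_G_one hh₁ hB₁ x σ).neg.congr
          (Filter.Eventually.of_forall fun ξ => ?_)
        simp)
    have e1 : ∫ ξ, h₁ (x + √σ * ξ) * (1 / (2 * √σ) * ξ) * G 1 ξ =
        1 / (2 * √σ) * ∫ ξ, h₁ (x + √σ * ξ) * (ξ * G 1 ξ) := by
      rw [← integral_const_mul]
      exact integral_congr_ae (Filter.Eventually.of_forall fun ξ => by ring)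
    have e2 : ∫ ξ, h₂ (x + √σ * ξ) * √σ * -G 1 ξ = -√σ * heatAvg h₂ x σ := by
      rw [heatAvg, ← integral_const_mul]
      exact integral_congr_ae (Filter.Eventually.of_forall fun ξ => by ring)
    rw [e1, ibp, e2]
    field_simp
  · have hτ' : σ / 2 < τ := hτ
    have h0 : 0 < √(σ / 2) := sqrt_pos.2 (by linarith)
    have h1 : √(σ / 2) ≤ √τ := sqrt_le_sqrt hτ'.le
    rw [show h₁ (x + √τ * ξ) * (1 / (2 * √τ) * ξ) * G 1 ξ =
      h₁ (x + √τ * ξ) * (1 / (2 * √τ)) * (ξ * G 1 ξ) by ring, norm_mul, norm_mul]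
    have h2 : ‖1 / (2 * √τ)‖ ≤ 1 / (2 * √(σ / 2)) := by
      rw [norm_of_nonneg (by positivity)]
      gcongr
    exact mul_le_mul_of_nonneg_right (mul_le_mul (hB₁ _) h2 (norm_nonneg _)
      ((abs_nonneg _).trans (hB₁ 0))) (norm_nonneg _)
  · have hτ' : σ / 2 < τ := hτ
    have := (((hasDerivAt_sqrt (by linarith : τ ≠ 0)).mul_const ξ).const_add x)
    exact ((hd _).comp τ this).mul_const (G 1 ξ)

/-- Duhamel's formula for the space-time function `(1 - σ / T) h(x)`. -/
lemma integral_heatAvg_source {h h₁ h₂ : ℝ → ℝ} {B B₁ B₂ : ℝ}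
    (hd : ∀ x, HasDerivAt h (h₁ x) x) (hd₁ : ∀ x, HasDerivAt h₁ (h₂ x) x) (hc : Continuous h₂)
    (hB : ∀ x, |h x| ≤ B) (hB₁ : ∀ x, |h₁ x| ≤ B₁) (hB₂ : ∀ x, |h₂ x| ≤ B₂)
    (x : ℝ) {T : ℝ} (hT : 0 < T) :
    ∫ σ in (0 : ℝ)..T, (1 / T * heatAvg h x σ - (1 - σ / T) / 2 * heatAvg h₂ x σ) = h x := by
  have hh : Continuous h := continuous_iff_continuousAt.2 fun x => (hd x).continuousAt
  have c := continuous_heatAvg hh hB x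
  have c₂ := continuous_heatAvg hc hB₂ x
  rw [intervalIntegral.integral_eq_sub_of_hasDerivAt_of_le
    (f := fun σ => -((1 - σ / T) * heatAvg h x σ)) hT.le (by fun_prop) (fun σ hσ => ?_)
    (Continuous.intervalIntegrable (by fun_prop) _ _)]
  · simp [heatAvg_zero, hT.ne']
  · refine ((((hasDerivAt_id σ).div_const T).const_sub 1).mul
      (hasDerivAt_heatAvg hd hd₁ hc hB hB₁ hB₂ x hσ.1)).neg.congr_deriv ?_
    simp only [id_eq]
    ring

lemma G_le_rpow {t : ℝ} (ht : 0 < t) (x : ℝ) : G t x ≤ t ^ (-(1 / 2) : ℝ) := by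
  have h1 : exp (-x ^ 2 / (2 * t)) ≤ 1 := exp_le_one_iff.2
    (div_nonpos_of_nonpos_of_nonneg (neg_nonpos.2 (sq_nonneg x)) (by positivity))
  have h2 : 1 / √(2 * π * t) ≤ 1 / √t := by
    have : t ≤ 2 * π * t := by nlinarith [pi_gt_three]
    have := sqrt_pos.2 ht
    gcongr
  rw [G_of_pos ht, rpow_neg ht.le, ← sqrt_eq_rpow, ← one_div]
  exact (mul_le_of_le_one_right (by positivity) h1).trans h2

section Superposition

variable {ι : Type*} [Fintype ι] (c x : ι → ℝ)

lemma sq_sum_G_le {σ : ℝ} (hσ : 0 < σ) (z : ℝ) :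
    (∑ i, c i * G σ (x i - z)) ^ 2 ≤
      σ ^ (-(1 / 2) : ℝ) * Fintype.card ι * ∑ i, c i ^ 2 * G σ (x i - z) := by
  refine sq_sum_le_card_mul_sum_sq.trans ?_
  rw [mul_comm (σ ^ (-(1 / 2) : ℝ)), mul_assoc,
    Finset.mul_sum _ _ (σ ^ (-(1 / 2) : ℝ))]
  refine mul_le_mul_of_nonneg_left (Finset.sum_le_sum fun i _ => ?_) (Nat.cast_nonneg' _)
  have h := mul_le_mul_of_nonneg_right (G_le_rpow hσ (x i - z)) (G_nonneg σ (x i - z))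
  nlinarith [mul_le_mul_of_nonneg_left h (sq_nonneg (c i))]

lemma measurable_sum_G :
    Measurable (fun p : ℝ × ℝ => ∑ i, c i * G p.1 (x i - p.2)) :=
  Finset.measurable_sum _ fun _ _ =>
    (measurable_uncurry_G.comp (measurable_fst.prodMk (measurable_snd.const_sub _))).const_mul _

lemma integrable_sum_sq_mul_G {σ : ℝ} (hσ : 0 < σ) (C : ℝ) :
    Integrable (fun z => C * ∑ i, c i ^ 2 * G σ (x i - z)) :=
  (integrable_finsetSum _ fun _ _ => ((integrable_G hσ).comp_sub_left _).const_mul _).const_mul _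

lemma integrable_sq_sum_G {σ : ℝ} (hσ : 0 < σ) :
    Integrable (fun z => (∑ i, c i * G σ (x i - z)) ^ 2) := by
  refine (integrable_sum_sq_mul_G c x hσ (σ ^ (-(1 / 2) : ℝ) * Fintype.card ι)).mono'
    (((measurable_sum_G c x).comp measurable_prodMk_left).pow_const 2).aestronglyMeasurable
    (Filter.Eventually.of_forall fun z => ?_)
  rw [norm_of_nonneg (sq_nonneg _)]
  exact sq_sum_G_le c x hσ z

lemma integral_sq_sum_G_le {σ : ℝ} (hσ : 0 < σ) :
    ∫ z, (∑ i, c i * G σ (x i - z)) ^ 2 ≤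
      σ ^ (-(1 / 2) : ℝ) * (Fintype.card ι * ∑ i, c i ^ 2) := by
  refine (integral_mono (integrable_sq_sum_G c x hσ) (integrable_sum_sq_mul_G c x hσ _)
    (sq_sum_G_le c x hσ)).trans_eq ?_
  rw [integral_const_mul, integral_finsetSum _ fun i _ =>
    ((integrable_G hσ).comp_sub_left _).const_mul _, mul_assoc]
  congr 3 with i
  rw [integral_const_mul, integral_sub_left_eq_self (G σ) volume, integral_G hσ, mul_one]

lemma intervalIntegrable_integral_sq_sum_G {T : ℝ} (hT : 0 ≤ T) :
    IntervalIntegrable (fun σ => ∫ z, (∑ i, c i * G σ (x i - z)) ^ 2) volume 0 T := by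
  refine IntervalIntegrable.mono_fun'
    ((intervalIntegral.intervalIntegrable_rpow' (r := -(1 / 2)) (by norm_num)).mul_const
      (Fintype.card ι * ∑ i, c i ^ 2))
    (StronglyMeasurable.integral_prod_right
      ((measurable_sum_G c x).pow_const 2).stronglyMeasurable).aestronglyMeasurable ?_
  rw [Set.uIoc_of_le hT]
  filter_upwards [ae_restrict_mem measurableSet_Ioc] with σ hσ
  rw [norm_of_nonneg (integral_nonneg fun _ => sq_nonneg _)]
  exact integral_sq_sum_G_le c x hσ.1

/-- Duality bound: a test function whose source is square-integrable bounds the energy of a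
superposition of heat kernels from below. -/
lemma two_mul_sum_le_energy {h h₁ h₂ : ℝ → ℝ} {B B₁ B₂ : ℝ}
    (hd : ∀ x, HasDerivAt h (h₁ x) x) (hd₁ : ∀ x, HasDerivAt h₁ (h₂ x) x) (hc : Continuous h₂)
    (hB : ∀ x, |h x| ≤ B) (hB₁ : ∀ x, |h₁ x| ≤ B₁) (hB₂ : ∀ x, |h₂ x| ≤ B₂)
    {T : ℝ} (hT : 0 < T) {ψ : ℝ → ℝ} (hψ : Integrable ψ)
    (hψ' : ∀ σ ∈ Set.Ioo 0 T, ∀ z, (1 / T * h z - (1 - σ / T) / 2 * h₂ z) ^ 2 ≤ ψ z)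
    {l : ℝ} (hl : 0 < l) :
    2 * ∑ i, c i * h (x i) ≤
      l * (∫ σ in (0 : ℝ)..T, ∫ z, (∑ i, c i * G σ (x i - z)) ^ 2) + T * (∫ z, ψ z) / l := by
  have hh : Continuous h := continuous_iff_continuousAt.2 fun x => (hd x).continuousAt
  have ca := fun i => continuous_heatAvg hh hB (x i)
  have ca₂ := fun i => continuous_heatAvg hc hB₂ (x i)
  have e : 2 * ∑ i, c i * h (x i) = ∫ σ in (0 : ℝ)..T, 2 * ∑ i, c i *
      (1 / T * heatAvg h (x i) σ - (1 - σ / T) / 2 * heatAvg h₂ (x i) σ) := by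
    rw [intervalIntegral.integral_const_mul, intervalIntegral.integral_finsetSum]
    · simp_rw [intervalIntegral.integral_const_mul,
        integral_heatAvg_source hd hd₁ hc hB hB₁ hB₂ _ hT]
    · exact fun i _ => Continuous.intervalIntegrable (by fun_prop) _ _
  have hQ := (intervalIntegrable_integral_sq_sum_G c x hT.le).const_mul l
  have e' : l * (∫ σ in (0 : ℝ)..T, ∫ z, (∑ i, c i * G σ (x i - z)) ^ 2) + T * (∫ z, ψ z) / l =
      ∫ σ in (0 : ℝ)..T, (l * (∫ z, (∑ i, c i * G σ (x i - z)) ^ 2) + (∫ z, ψ z) / l) := by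
    rw [intervalIntegral.integral_add hQ intervalIntegrable_const,
      intervalIntegral.integral_const_mul, intervalIntegral.integral_const, smul_eq_mul]
    ring
  rw [e, e']
  refine intervalIntegral.integral_mono_on_of_le_Ioo hT.le
    (Continuous.intervalIntegrable (by fun_prop) _ _) (hQ.add intervalIntegrable_const)
    fun σ hσ => ?_
  have i₀ : ∀ i, Integrable (fun z => G σ (x i - z) * h z) := fun i =>
    ((integrable_G hσ.1).comp_sub_left (x i)).mul_bdd hh.aestronglyMeasurable
      (Filter.Eventually.of_forall hB)
  have i₂ : ∀ i, Integrable (fun z => G σ (x i - z) * h₂ z) := fun i =>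
    ((integrable_G hσ.1).comp_sub_left (x i)).mul_bdd hc.aestronglyMeasurable
      (Filter.Eventually.of_forall hB₂)
  have i₃ : ∀ i, Integrable (fun z => c i * (1 / T * (G σ (x i - z) * h z) -
      (1 - σ / T) / 2 * (G σ (x i - z) * h₂ z))) := fun i =>
    (((i₀ i).const_mul _).sub ((i₂ i).const_mul _)).const_mul _
  have e₁ : ∑ i, c i * (1 / T * heatAvg h (x i) σ - (1 - σ / T) / 2 * heatAvg h₂ (x i) σ) =
      ∫ z, ∑ i, c i * (1 / T * (G σ (x i - z) * h z) -
      (1 - σ / T) / 2 * (G σ (x i - z) * h₂ z)) := by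
    rw [integral_finsetSum _ fun i _ => i₃ i]
    refine Finset.sum_congr rfl fun i _ => ?_
    rw [integral_const_mul, integral_sub ((i₀ i).const_mul _) ((i₂ i).const_mul _),
      integral_const_mul, integral_const_mul, heatAvg_eq_integral_G _ _ hσ.1,
      heatAvg_eq_integral_G _ _ hσ.1]
  have iw := (integrable_sq_sum_G c x hσ.1).const_mul l
  rw [e₁, ← integral_const_mul, ← integral_const_mul, ← integral_div,
    ← integral_add iw (hψ.div_const l)]
  refine integral_mono ((integrable_finsetSum _ fun i _ => i₃ i).const_mul 2)
    (iw.add (hψ.div_const l)) fun z => ?_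
  have e₂ : ∑ i, c i * (1 / T * (G σ (x i - z) * h z) -
      (1 - σ / T) / 2 * (G σ (x i - z) * h₂ z)) =
      (∑ i, c i * G σ (x i - z)) * (1 / T * h z - (1 - σ / T) / 2 * h₂ z) := by
    rw [Finset.sum_mul]
    exact Finset.sum_congr rfl fun i _ => by ring
  simp only [e₂]
  set w := ∑ i, c i * G σ (x i - z)
  set φ := 1 / T * h z - (1 - σ / T) / 2 * h₂ z
  have h₃ : φ ^ 2 / l ≤ ψ z / l := div_le_div_of_nonneg_right (hψ' σ hσ z) hl.le
  have h₄ : 0 ≤ (l * w - φ) ^ 2 / l := by positivity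
  have h₅ : (l * w - φ) ^ 2 / l = l * w ^ 2 - 2 * (w * φ) + φ ^ 2 / l := by
    field_simp; ring
  linarith

end Superposition

lemma exists_test_function : ∃ (h h₁ h₂ : ℝ → ℝ) (B B₁ B₂ : ℝ),
    (∀ x, HasDerivAt h (h₁ x) x) ∧ (∀ x, HasDerivAt h₁ (h₂ x) x) ∧ Continuous h₂ ∧
    (∀ x, |h x| ≤ B) ∧ (∀ x, |h₁ x| ≤ B₁) ∧ (∀ x, |h₂ x| ≤ B₂) ∧
    h 0 = 1 ∧ (∀ x, 1 ≤ |x| → h x = 0) ∧ (∀ x, 1 < |x| → h₂ x = 0) := by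
  let f : ContDiffBump (0 : ℝ) := ⟨1 / 2, 1, by norm_num, by norm_num⟩
  have hf : ContDiff ℝ 2 f := f.contDiff
  have hf₁ : ContDiff ℝ 1 (deriv f) := hf.deriv'
  have hf₂ : Continuous (deriv (deriv f)) := hf₁.continuous_deriv le_rfl
  obtain ⟨B, hB⟩ := f.hasCompactSupport.exists_bound_of_continuous hf.continuous
  obtain ⟨B₁, hB₁⟩ := f.hasCompactSupport.deriv.exists_bound_of_continuous hf₁.continuous
  obtain ⟨B₂, hB₂⟩ := f.hasCompactSupport.deriv.deriv.exists_bound_of_continuous hf₂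
  refine ⟨f, deriv f, deriv (deriv f), B, B₁, B₂,
    fun x => (hf.differentiable (by norm_num) x).hasDerivAt,
    fun x => (hf₁.differentiable (by norm_num) x).hasDerivAt, hf₂, hB, hB₁, hB₂,
    f.one_of_mem_closedBall (by simp [f]), fun x hx => f.zero_of_le_dist (by simpa [f] using hx),
    fun x hx => ?_⟩
  by_contra hne
  have := tsupport_deriv_subset (support_deriv_subset (Function.mem_support.2 hne))
  rw [f.tsupport_eq] at this
  simp [f] at this
  linarith

theorem stmt_18 (t : ℝ) (ht : 0 < t) (a b : ℝ) (hab : a < b) :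
    ∃ K : ℝ, 0 < K ∧ ∀ r : ℝ, 0 < r → r ≤ b - a →
      ∀ n : ℕ, 1 ≤ n → ∀ coef : Fin n → ℝ, ∀ xs : Fin n → ℝ, ∀ y : ℝ,
        y ∈ Set.Icc a b →
        (∀ k, xs k ∈ Set.Icc a b ∧ r ≤ |y - xs k| ∧ |y - xs k| ≤ b - a) →
        K * r ≤ ∫ s in (0:ℝ)..t, ∫ z : ℝ,
          (G (t - s) (y - z) - ∑ k, coef k * G (t - s) (xs k - z)) ^ 2 := by
  obtain ⟨h, h₁, h₂, B, B₁, B₂, hd, hd₁, hc, hB, hB₁, hB₂, h0, hz, hz₂⟩ := exists_test_function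
  have hba : 0 < b - a := sub_pos.2 hab
  set d : ℝ := t / (b - a) ^ 2 with hdef
  have hd0 : 0 < d := by positivity
  have hB0 : 1 ≤ B := by simpa [h0] using hB 0
  have hB20 : 0 ≤ B₂ := (abs_nonneg _).trans (hB₂ 0)
  set A : ℝ := B / d + B₂ with hA
  have hA0 : 0 < A := by positivity
  set M : ℝ := 2 * d * A ^ 2 with hM
  have hM0 : 0 < M := by positivity
  refine ⟨1 / M, by positivity, fun r hr hrb n _ coef xs y _ hxs => ?_⟩
  set T : ℝ := d * r ^ 2 with hTdef
  have hT : 0 < T := by positivity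
  have hTt : T ≤ t := by
    rw [hTdef, hdef, div_mul_eq_mul_div, div_le_iff₀ (by positivity)]
    gcongr
  let c : Option (Fin n) → ℝ := fun o => o.elim 1 fun k => -coef k
  let x : Option (Fin n) → ℝ := fun o => o.elim y xs
  have hw : ∀ s z, G (t - s) (y - z) - ∑ k, coef k * G (t - s) (xs k - z) =
      ∑ i, c i * G (t - s) (x i - z) := fun s z => by
    simp [Fintype.sum_option, c, x, sub_eq_add_neg]
  simp_rw [hw]
  rw [intervalIntegral.integral_comp_sub_left
    (fun σ => ∫ z, (∑ i, c i * G σ (x i - z)) ^ 2) t, sub_self, sub_zero]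
  refine le_trans ?_ (intervalIntegral.integral_mono_interval le_rfl hT.le hTt
    (Filter.Eventually.of_forall fun σ => integral_nonneg fun z => sq_nonneg _)
    (intervalIntegrable_integral_sq_sum_G c x ht.le))
  have hsc : ∀ z, HasDerivAt (fun z => (z - y) / r) (1 / r) z := fun z =>
    ((hasDerivAt_id z).sub_const y).div_const r
  have habs : ∀ z, |(z - y) / r| = |z - y| / r := fun z => by rw [abs_div, abs_of_pos hr]
  have key := two_mul_sum_le_energy c x (h := fun z => h ((z - y) / r))
    (h₁ := fun z => h₁ ((z - y) / r) * (1 / r))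
    (h₂ := fun z => h₂ ((z - y) / r) * (1 / r) * (1 / r)) (B := B)
    (B₁ := B₁ * (1 / r)) (B₂ := B₂ * (1 / r) * (1 / r))
    (fun z => (hd _).comp z (hsc z))
    (fun z => ((hd₁ _).comp z (hsc z)).mul_const _) (by fun_prop) (fun z => hB _)
    (fun z => by
      rw [abs_mul, abs_of_pos (one_div_pos.2 hr)]
      exact mul_le_mul_of_nonneg_right (hB₁ _) (by positivity))
    (fun z => by
      rw [abs_mul, abs_mul, abs_of_pos (one_div_pos.2 hr)]
      gcongr
      exact hB₂ _)
    hT (ψ := (Set.Icc (y - r) (y + r)).indicator fun _ => (A / r ^ 2) ^ 2)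
    ((integrable_indicator_iff measurableSet_Icc).2 (integrableOn_const (by simp)))
    (fun σ hσ z => ?_) (l := M / r) (by positivity)
  · rw [integral_indicator measurableSet_Icc, setIntegral_const, Fintype.sum_option] at key
    have hk : ∀ k, h ((xs k - y) / r) = 0 := fun k => hz _ (by
      rw [habs, abs_sub_comm, one_le_div hr]; exact (hxs k).2.1)
    simp only [c, x, Option.elim, sub_self, zero_div, h0, hk, mul_zero, Finset.sum_const_zero,
      measureReal_def, Real.volume_Icc, smul_eq_mul] at key
    rw [ENNReal.toReal_ofReal (by linarith)] at key
    have e : T * ((y + r - (y - r)) * (A / r ^ 2) ^ 2) / (M / r) = 1 := by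
      rw [hTdef, hM]; field_simp; ring
    rw [e] at key
    rw [one_div_mul_eq_div, div_le_iff₀ hM0]
    have key' : 2 * (1 * 1 + 0) ≤
      M / r * (∫ σ in (0 : ℝ)..T, ∫ z, (∑ i, c i * G σ (x i - z)) ^ 2) + 1 := key
    have h3 : 1 ≤ M / r * ∫ σ in (0 : ℝ)..T, ∫ z, (∑ i, c i * G σ (x i - z)) ^ 2 := by
      linarith
    rw [div_mul_eq_mul_div, one_le_div hr] at h3
    linarith
  · by_cases hmem : z ∈ Set.Icc (y - r) (y + r)
    · rw [Set.indicator_of_mem hmem]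
      have hs0 : 0 < σ / T := div_pos hσ.1 hT
      have hs1 : σ / T < 1 := (div_lt_one hT).2 hσ.2
      have e : A / r ^ 2 = 1 / T * B + 1 * (B₂ * (1 / r) * (1 / r)) := by
        rw [hA, hTdef]; field_simp
      rw [← sq_abs, e]
      refine pow_le_pow_left₀ (abs_nonneg _) ((abs_sub _ _).trans (add_le_add ?_ ?_)) 2
      · rw [abs_mul, abs_of_pos (one_div_pos.2 hT)]
        gcongr
        exact hB _
      · rw [abs_mul, abs_mul, abs_mul, abs_of_pos (one_div_pos.2 hr)]
        gcongr
        · rw [abs_le]; constructor <;> linarith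
        · exact hB₂ _
    · rw [Set.indicator_of_notMem hmem]
      have hgt : 1 < |(z - y) / r| := by
        rw [habs, one_lt_div hr]
        by_contra! hle
        exact hmem ⟨by linarith [(abs_le.1 hle).1], by linarith [(abs_le.1 hle).2]⟩
      simp [hz _ hgt.le, hz₂ _ hgt]
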